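/- For every real number t and all integers n ≥ 1 and k ≥ 1, (∑_{ω ∈ G_n} c_ω^t)^k ≤ ∑_{ω ∈ L_{n·k}} c_ω^t. -/

import Mathlib

open Filter

/-- The weight `c_ω` of a word `ω` over the alphabet `{0,1}` (here `false` is the
letter 0 and `true` is the letter 1): the product of `c0` over letters 0 and `c1`
over letters 1. -/
noncomputable def wt (c0 c1 : ℝ) (w : List Bool) : ℝ :=
  (w.map fun b => if b then c1 else c0).prod

/-- All words of length `n` over the alphabet `{0,1}`. -/
def allWords : ℕ → Finset (List Bool)
  | 0 => {[]}
  | n + 1 => (allWords n).biUnion fun w => {false :: w, true :: w}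

/-- Membership in the language of the S-gap shift: every maximal block of 0s lying
strictly between two 1s has length in `S`. -/
def InLang (S : Set ℕ) (w : List Bool) : Prop :=
  ∀ u v : List Bool, ∀ m : ℕ,
    w = u ++ [true] ++ List.replicate m false ++ [true] ++ v → m ∈ S

/-- Membership in the core set `G`: words of the form `0^{s₁}1 0^{s₂}1 ⋯ 0^{s_k}1`
with `k ≥ 1` and every `s_i ∈ S`. -/
def InCore (S : Set ℕ) (w : List Bool) : Prop :=
  ∃ bs : List ℕ, bs ≠ [] ∧ (∀ s ∈ bs, s ∈ S) ∧
    w = (bs.map fun s => List.replicate s false ++ [true]).flatten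

/-- `L_n`: the words of length `n` in the language of the S-gap shift. -/
noncomputable def langWords (S : Set ℕ) (n : ℕ) : Finset (List Bool) :=
  @Finset.filter _ (InLang S) (Classical.decPred _) (allWords n)

/-- `G_n`: the core words of length `n`. -/
noncomputable def coreWords (S : Set ℕ) (n : ℕ) : Finset (List Bool) :=
  @Finset.filter _ (InCore S) (Classical.decPred _) (allWords n)

theorem mem_allWords {n : ℕ} {w : List Bool} : w ∈ allWords n ↔ w.length = n := by
  induction n generalizing w with
  | zero => simp [allWords]
  | succ n ih => cases w with
    | nil => simp [allWords]
    | cons b w => cases b <;> simp [allWords, ih]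

theorem mem_langWords {S : Set ℕ} {n : ℕ} {w : List Bool} :
    w ∈ langWords S n ↔ w.length = n ∧ InLang S w := by
  simp [langWords, mem_allWords]

theorem mem_coreWords {S : Set ℕ} {n : ℕ} {w : List Bool} :
    w ∈ coreWords S n ↔ w.length = n ∧ InCore S w := by
  simp [coreWords, mem_allWords]

theorem InCore.append {S : Set ℕ} {v w : List Bool} (hv : InCore S v) (hw : InCore S w) :
    InCore S (v ++ w) := by
  obtain ⟨as, has, hS, rfl⟩ := hv
  obtain ⟨bs, -, hS', rfl⟩ := hw
  refine ⟨as ++ bs, by simp [has], ?_, by simp⟩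
  intro s hs
  rcases List.mem_append.1 hs with h | h
  exacts [hS s h, hS' s h]

theorem replicate_false_append_true_inj {s m : ℕ} {x y : List Bool}
    (h : List.replicate s false ++ true :: x = List.replicate m false ++ true :: y) :
    s = m := by
  induction s generalizing m with
  | zero => cases m <;> simp_all [List.replicate_succ]
  | succ s ih => cases m with
    | zero => simp [List.replicate_succ] at h
    | succ m =>
      simp only [List.replicate_succ, List.cons_append, List.cons.injEq, true_and] at h
      rw [ih h]

/-- What follows a letter 1 in a concatenation of blocks `0^s 1` is again such a
concatenation, with blocks taken from the original ones. -/
theorem exists_blocks_of_append_true {bs : List ℕ} {u x : List Bool}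
    (h : (bs.map fun s => List.replicate s false ++ [true]).flatten = u ++ true :: x) :
    ∃ cs : List ℕ, cs ⊆ bs ∧
      x = (cs.map fun s => List.replicate s false ++ [true]).flatten := by
  induction bs generalizing u with
  | nil => simp at h
  | cons s bs ih =>
    simp only [List.map_cons, List.flatten_cons, List.append_assoc, List.singleton_append] at h
    rcases List.append_eq_append_iff.1 h with ⟨a, -, ha⟩ | ⟨c, hc, hx⟩
    · cases a with
      | nil =>
        simp only [List.nil_append, List.cons.injEq, true_and] at ha
        exact ⟨bs, by simp, ha.symm⟩
      | cons b a =>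
        simp only [List.cons_append, List.cons.injEq] at ha
        obtain ⟨cs, hcs, hx⟩ := ih ha.2
        exact ⟨cs, List.subset_cons_of_subset s hcs, hx⟩
    · cases c with
      | nil =>
        simp only [List.nil_append, List.cons.injEq, true_and] at hx
        exact ⟨bs, by simp, hx⟩
      | cons b c =>
        simp only [List.cons_append, List.cons.injEq] at hx
        have hb : b ∈ List.replicate s false := by simp [hc]
        exact absurd (hx.1.trans (List.eq_of_mem_replicate hb)) (by decide)

theorem InCore.inLang {S : Set ℕ} {w : List Bool} (hw : InCore S w) : InLang S w := by
  obtain ⟨bs, -, hS, rfl⟩ := hw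
  intro u v m h
  simp only [List.append_assoc, List.singleton_append] at h
  obtain ⟨cs, hcs, hx⟩ := exists_blocks_of_append_true h
  cases cs with
  | nil => simp at hx
  | cons s cs =>
    simp only [List.map_cons, List.flatten_cons, List.append_assoc, List.singleton_append] at hx
    rw [replicate_false_append_true_inj hx]
    exact hS s (hcs (by simp))

theorem coreWords_subset_langWords (S : Set ℕ) (n : ℕ) : coreWords S n ⊆ langWords S n := by
  intro w hw
  rw [mem_coreWords] at hw
  exact mem_langWords.2 ⟨hw.1, hw.2.inLang⟩

theorem wt_append (c0 c1 : ℝ) (v w : List Bool) :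
    wt c0 c1 (v ++ w) = wt c0 c1 v * wt c0 c1 w := by
  simp [wt]

theorem wt_pos {c0 c1 : ℝ} (h0 : 0 < c0) (h1 : 0 < c1) (w : List Bool) : 0 < wt c0 c1 w := by
  refine List.prod_pos fun a ha => ?_
  obtain ⟨b, -, rfl⟩ := List.mem_map.1 ha
  cases b <;> simpa

/-- The weighted sums over core words are supermultiplicative in the length. -/
theorem sum_coreWords_mul_le {c0 c1 : ℝ} (h0 : 0 < c0) (h1 : 0 < c1) (S : Set ℕ) (t : ℝ)
    (m n : ℕ) :
    (∑ ω ∈ coreWords S m, wt c0 c1 ω ^ t) * ∑ ω ∈ coreWords S n, wt c0 c1 ω ^ t ≤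
      ∑ ω ∈ coreWords S (m + n), wt c0 c1 ω ^ t := by
  have hinj : Set.InjOn (fun p : List Bool × List Bool => p.1 ++ p.2)
      (coreWords S m ×ˢ coreWords S n : Finset (List Bool × List Bool)) := by
    rintro ⟨v, w⟩ hp ⟨v', w'⟩ hp' h
    simp only [Finset.coe_product, Set.mem_prod, Finset.mem_coe, mem_coreWords] at hp hp'
    obtain ⟨rfl, rfl⟩ := List.append_inj h (hp.1.1.trans hp'.1.1.symm)
    rfl
  calc _ = ∑ p ∈ coreWords S m ×ˢ coreWords S n, wt c0 c1 (p.1 ++ p.2) ^ t := by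
        rw [Finset.sum_mul_sum, ← Finset.sum_product']
        refine Finset.sum_congr rfl fun p _ => ?_
        rw [wt_append, Real.mul_rpow (wt_pos h0 h1 _).le (wt_pos h0 h1 _).le]
    _ = ∑ ω ∈ (coreWords S m ×ˢ coreWords S n).image (fun p => p.1 ++ p.2),
          wt c0 c1 ω ^ t := (Finset.sum_image (f := fun ω => wt c0 c1 ω ^ t) hinj).symm
    _ ≤ _ := by
        refine Finset.sum_le_sum_of_subset_of_nonneg ?_
          fun ω _ _ => Real.rpow_nonneg (wt_pos h0 h1 ω).le t
        intro ω hω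
        obtain ⟨p, hp, rfl⟩ := Finset.mem_image.1 hω
        simp only [Finset.mem_product, mem_coreWords] at hp
        exact mem_coreWords.2 ⟨by simp [hp.1.1, hp.2.1], hp.1.2.append hp.2.2⟩

/-- For every real t and all n ≥ 1, k ≥ 1,
(∑_{ω ∈ G_n} c_ω^t)^k ≤ ∑_{ω ∈ L_{n·k}} c_ω^t. -/
theorem stmt16
    (S : Set ℕ) (hS : S.Infinite)
    (c0 c1 cb0 cb1 : ℝ)
    (hc0 : 0 < c0) (hc0b : c0 ≤ cb0) (hcb0 : cb0 < 1)
    (hc1 : 0 < c1) (hc1b : c1 ≤ cb1) (hcb1 : cb1 < 1) :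
    ∀ t : ℝ, ∀ n k : ℕ, 1 ≤ n → 1 ≤ k →
      (∑ ω ∈ coreWords S n, wt c0 c1 ω ^ t) ^ k ≤
        ∑ ω ∈ langWords S (n * k), wt c0 c1 ω ^ t := by
  intro t n k _ hk
  have hnonneg : ∀ ω, 0 ≤ wt c0 c1 ω ^ t := fun ω => Real.rpow_nonneg (wt_pos hc0 hc1 ω).le t
  refine le_trans ?_ (Finset.sum_le_sum_of_subset_of_nonneg
    (coreWords_subset_langWords S (n * k)) fun ω _ _ => hnonneg ω)
  induction k, hk using Nat.le_induction with
  | base => simp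
  | succ k _ ih =>
    rw [pow_succ, Nat.mul_succ]
    exact (mul_le_mul_of_nonneg_right ih (Finset.sum_nonneg fun ω _ => hnonneg ω)).trans
      (sum_coreWords_mul_le hc0 hc1 S t (n * k) n)
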